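/- Let G be a finite simple graph on vertex set V, and let V1, V2 ⊆ V with V1 ∪ V2 = V be such that every edge of G has both endpoints in V1 or both endpoints in V2, and such that Y = V1 ∩ V2 is an independent set of G. Then G has a perfect matching if and only if there exists a subset Z ⊆ Y such that the induced subgraph G[V1 \ Z] has a perfect matching and the induced subgraph G[V2 \ (Y \ Z)] has a perfect matching. (This is the gluing fact underlying the identity (G1·G2)^M = G1^M * G2^M for the matching monoid of grid layered planar graphs.) -/

import Mathlib

namespace SimpleGraph.Subgraph

/-- A perfect matching restricts to a perfect matching of the subgraph induced on any set that is
closed under passing to the matching partner. -/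
theorem IsPerfectMatching.comap_induce {V : Type*} {G : SimpleGraph V} {M : G.Subgraph}
    (hM : M.IsPerfectMatching) (S : Set V) (hS : ∀ v w, M.Adj v w → v ∈ S → w ∈ S) :
    (M.comap (Embedding.induce (G := G) S).toHom).IsPerfectMatching := by
  rw [isPerfectMatching_iff] at hM ⊢
  rintro ⟨v, hv⟩
  obtain ⟨w, hw, hu⟩ := hM v
  refine ⟨⟨w, hS v w hw hv⟩, ⟨M.adj_sub hw, hw⟩, ?_⟩
  rintro ⟨x, hx⟩ hxa
  exact Subtype.ext (hu x hxa.2)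

/-- Perfect matchings of the subgraphs induced on two complementary sets combine to a perfect
matching of the whole graph. -/
theorem IsPerfectMatching.exists_of_induce {V : Type*} {G : SimpleGraph V} {S T : Set V}
    (hST : IsCompl S T) {M : (G.induce S).Subgraph} {N : (G.induce T).Subgraph}
    (hM : M.IsPerfectMatching) (hN : N.IsPerfectMatching) :
    ∃ P : G.Subgraph, P.IsPerfectMatching := by
  have hMv : (M.map (Embedding.induce (G := G) S).toHom).verts = S := by
    rw [map_verts, hM.2.verts_eq_univ, Set.image_univ]
    exact Subtype.range_coe
  have hNv : (N.map (Embedding.induce (G := G) T).toHom).verts = T := by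
    rw [map_verts, hN.2.verts_eq_univ, Set.image_univ]
    exact Subtype.range_coe
  have hM' := hM.1.map (Embedding.induce (G := G) S).toHom Subtype.val_injective
  have hN' := hN.1.map (Embedding.induce (G := G) T).toHom Subtype.val_injective
  refine ⟨_, hM'.sup hN' ?_, ?_⟩
  · rw [hM'.support_eq_verts, hN'.support_eq_verts, hMv, hNv]
    exact hST.disjoint
  · rw [isSpanning_iff, verts_sup, hMv, hNv]
    exact hST.sup_eq_top

end SimpleGraph.Subgraph

/-- Let `G` be a finite simple graph on vertex set `V`, and let
`V1, V2 ⊆ V` with `V1 ∪ V2 = V` be such that every edge of `G` has both endpoints in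
`V1` or both endpoints in `V2`, and such that `Y = V1 ∩ V2` is an independent set of
`G`. Then `G` has a perfect matching if and only if there exists `Z ⊆ Y` such that
the induced subgraph `G[V1 \ Z]` has a perfect matching and the induced subgraph
`G[V2 \ (Y \ Z)]` has a perfect matching. -/
theorem pm_glue {V : Type*} [Fintype V] (G : SimpleGraph V) (V1 V2 : Set V)
    (hcover : V1 ∪ V2 = Set.univ)
    (hedges : ∀ v w, G.Adj v w → (v ∈ V1 ∧ w ∈ V1) ∨ (v ∈ V2 ∧ w ∈ V2))
    (hindep : ∀ v ∈ V1 ∩ V2, ∀ w ∈ V1 ∩ V2, ¬ G.Adj v w) :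
    (∃ M : G.Subgraph, M.IsPerfectMatching) ↔
      ∃ Z ⊆ V1 ∩ V2,
        (∃ M : (G.induce (V1 \ Z)).Subgraph, M.IsPerfectMatching) ∧
        (∃ M : (G.induce (V2 \ ((V1 ∩ V2) \ Z))).Subgraph, M.IsPerfectMatching) := by
  constructor
  · rintro ⟨M, hM⟩
    have key : ∀ v w, M.Adj v w → (v ∈ V1 ∧ w ∈ V1 ∨ v ∈ V2 ∧ w ∈ V2) ∧
        ¬ ((v ∈ V1 ∧ v ∈ V2) ∧ w ∈ V1 ∧ w ∈ V2) := fun v w h =>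
      ⟨hedges v w h.adj_sub, fun hY => hindep v hY.1 w hY.2 h.adj_sub⟩
    have partner_mem : ∀ v w, M.Adj v w → ((∃ x ∈ V2, M.Adj v x) ↔ w ∈ V2) := fun v w h =>
      ⟨fun ⟨_, hx, hvx⟩ => hM.1.eq_of_adj_left hvx h ▸ hx, fun hw => ⟨w, hw, h⟩⟩
    refine ⟨{v | (v ∈ V1 ∧ v ∈ V2) ∧ ∃ x ∈ V2, M.Adj v x}, fun v hv => hv.1,
      ⟨_, hM.comap_induce _ ?_⟩, ⟨_, hM.comap_induce _ ?_⟩⟩ <;>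
    · intro v w h hv
      have h1 := key v w h
      simp only [Set.mem_sdiff, Set.mem_inter_iff, Set.mem_ofPred_eq, partner_mem v w h,
        partner_mem w v h.symm] at hv ⊢
      tauto
  · rintro ⟨Z, hZ, ⟨M, hM⟩, ⟨N, hN⟩⟩
    refine hM.exists_of_induce (IsCompl.of_eq ?_ ?_) hN
    · ext v
      simp only [Set.inf_eq_inter, Set.bot_eq_empty, Set.mem_inter_iff, Set.mem_sdiff,
        Set.mem_empty_iff_false]
      tauto
    · ext v
      have hv : v ∈ V1 ∪ V2 := hcover ▸ Set.mem_univ v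
      have hZv := @hZ v
      simp only [Set.sup_eq_union, Set.top_eq_univ, Set.mem_union, Set.mem_inter_iff,
        Set.mem_sdiff, Set.mem_univ, iff_true] at hv hZv ⊢
      tauto
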